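/- arXiv:2311.14036 — 3 statements merged into one kernel-verified Lean document; each statement's English description precedes it below -/
import Mathlib

section
/- Let G be a group and H a subgroup of G whose centralizer C_G(H) = {g ∈ G : gh = hg for all h ∈ H} is finite. Let Ψ and Θ be automorphisms of G such that Ψ(h) = h and Θ(h) = h for every h ∈ H, and suppose that Ψ = conj(g) ∘ Θ for some g ∈ G (i.e. Ψ and Θ represent the same outer automorphism of G). Then there exists N ≥ 1 such that Ψ^N = Θ^N. -/
/-- An automorphism fixing `H` elementwise preserves the centralizer of `H`. -/
theorem apply_mem_centralizer_of_fix {G : Type*} [Group G] {H : Subgroup G} {Ψ : MulAut G}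
    (hΨ : ∀ h ∈ H, Ψ h = h) {c : G} (hc : c ∈ Subgroup.centralizer (H : Set G)) :
    Ψ c ∈ Subgroup.centralizer (H : Set G) := by
  rw [Subgroup.mem_centralizer_iff] at hc ⊢
  intro h hh
  simpa [hΨ h hh] using congrArg Ψ (hc h hh)

/-- If `Ψ = conj g * Θ` with `g` centralizing `H` and `Ψ` fixing `H` elementwise, then every
power of `Ψ` differs from that of `Θ` by conjugation by an element centralizing `H`. -/
theorem exists_mem_centralizer_pow_eq_conj_mul_pow {G : Type*} [Group G] {H : Subgroup G}
    {Ψ Θ : MulAut G} (hΨ : ∀ h ∈ H, Ψ h = h) {g : G}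
    (hg : g ∈ Subgroup.centralizer (H : Set G)) (hconj : Ψ = MulAut.conj g * Θ) (n : ℕ) :
    ∃ c ∈ Subgroup.centralizer (H : Set G), Ψ ^ n = MulAut.conj c * Θ ^ n := by
  induction n with
  | zero => exact ⟨1, one_mem _, by simp⟩
  | succ n ih =>
    obtain ⟨c, hc, hn⟩ := ih
    refine ⟨Ψ c * g, mul_mem (apply_mem_centralizer_of_fix hΨ hc) hg, ?_⟩
    have hcomm : Ψ * MulAut.conj c = MulAut.conj (Ψ c) * Ψ := by
      ext x
      simp
    calc Ψ ^ (n + 1) = Ψ * MulAut.conj c * Θ ^ n := by rw [pow_succ', hn, mul_assoc]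
      _ = MulAut.conj (Ψ c) * (MulAut.conj g * Θ) * Θ ^ n := by rw [hcomm, ← hconj]
      _ = MulAut.conj (Ψ c * g) * Θ ^ (n + 1) := by
        rw [map_mul, pow_succ']
        simp only [mul_assoc]

/-- If `Ψ` and `Θ` are automorphisms of `G` fixing a subgroup `H` elementwise,
whose centralizer in `G` is finite, and `Ψ`, `Θ` differ by an inner
automorphism, then some positive powers of `Ψ` and `Θ` coincide. -/
theorem pow_eq_of_fix_subgroup_finite_centralizer {G : Type*} [Group G]
    (H : Subgroup G) (hcent : (Subgroup.centralizer (H : Set G) : Set G).Finite)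
    (Ψ Θ : MulAut G)
    (hΨ : ∀ h ∈ H, Ψ h = h) (hΘ : ∀ h ∈ H, Θ h = h)
    (g : G) (hconj : Ψ = MulAut.conj g * Θ) :
    ∃ N : ℕ, 1 ≤ N ∧ Ψ ^ N = Θ ^ N := by
  have hg : g ∈ Subgroup.centralizer (H : Set G) := by
    rw [Subgroup.mem_centralizer_iff]
    intro h hh
    have hfix := hΨ h hh
    rw [hconj, MulAut.mul_apply, hΘ h hh, MulAut.conj_apply, mul_inv_eq_iff_eq_mul] at hfix
    exact hfix.symm
  choose c hc hpow using exists_mem_centralizer_pow_eq_conj_mul_pow hΨ hg hconj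
  obtain ⟨i, j, hij, heq⟩ := hcent.exists_lt_map_eq_of_forall_mem hc
  refine ⟨j - i, Nat.sub_pos_of_lt hij, mul_left_cancel (a := Ψ ^ i) ?_⟩
  rw [← pow_add, Nat.add_sub_cancel' hij.le, hpow j, hpow i, heq, mul_assoc, ← pow_add,
    Nat.add_sub_cancel' hij.le]
end

section
/- Let G be a finitely generated group and n ≥ 1. Then the set of subgroups of G of index exactly n is finite. -/
/-- There are only finitely many homomorphisms from a finitely generated group to a finite group. -/
theorem Group.FG.finite_monoidHom (G P : Type*) [Group G] [Group.FG G] [Group P] [Finite P] :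
    Finite (G →* P) := by
  obtain ⟨S, hS, hfin⟩ := Group.fg_iff.mp ‹Group.FG G›
  have : Finite S := hfin
  refine Finite.of_injective (fun (f : G →* P) (s : S) => f s) fun f g hfg => ?_
  exact MonoidHom.eq_of_eqOn_dense hS fun s hs => congrFun hfg ⟨s, hs⟩

/-- A subgroup of positive finite index `n` is the preimage of a point stabilizer under some
permutation representation on `Fin n`. -/
theorem Subgroup.exists_comap_stabilizer_eq {G : Type*} [Group G] {n : ℕ} (hn : n ≠ 0)
    {H : Subgroup G} (hH : H.index = n) :
    ∃ (f : G →* Equiv.Perm (Fin n)) (i : Fin n),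
      (MulAction.stabilizer (Equiv.Perm (Fin n)) i).comap f = H := by
  have : Finite (G ⧸ H) := Nat.finite_of_card_ne_zero (hH.trans_ne hn)
  let e : G ⧸ H ≃ Fin n := Finite.equivFinOfCardEq hH
  refine ⟨e.permCongrHom.toMonoidHom.comp (MulAction.toPermHom G (G ⧸ H)),
    e ((1 : G) : G ⧸ H), ?_⟩
  ext g
  have hg : (g : G ⧸ H) = (1 : G) ↔ g ∈ H := by
    rw [eq_comm, QuotientGroup.eq, inv_one, one_mul]
  simpa [MulAction.mem_stabilizer_iff, Equiv.permCongrHom] using hg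

/-- A finitely generated group has only finitely many subgroups of each
given finite index `n ≥ 1`. -/
theorem finite_subgroups_of_index {G : Type*} [Group G] [Group.FG G]
    (n : ℕ) (hn : 1 ≤ n) :
    {H : Subgroup G | H.index = n}.Finite := by
  have := Group.FG.finite_monoidHom G (Equiv.Perm (Fin n))
  refine (Set.finite_range fun p : (G →* Equiv.Perm (Fin n)) × Fin n =>
    (MulAction.stabilizer (Equiv.Perm (Fin n)) p.2).comap p.1).subset fun H hH => ?_
  obtain ⟨f, i, hfi⟩ := Subgroup.exists_comap_stabilizer_eq (Nat.one_le_iff_ne_zero.mp hn) hH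
  exact ⟨(f, i), hfi⟩
end

section
/- Let G be a group, F a nontrivial malnormal subgroup of G, Φ an automorphism of G, and g, g' ∈ G such that (conj(g)∘Φ)(F) = F and (conj(g')∘Φ)(F) = F. Then g'·g⁻¹ ∈ F; consequently the restrictions of conj(g)∘Φ and conj(g')∘Φ to F differ by an inner automorphism of F, and the suspensions F ⋊_{(conj(g)∘Φ)|_F} ℤ and F ⋊_{(conj(g')∘Φ)|_F} ℤ are isomorphic. (The suspension F_Φ of a malnormal subgroup does not depend on the choice of correcting element g.) -/
/-- A subgroup `F` of `G` is malnormal if `F ∩ gFg⁻¹ = {1}` for every `g ∉ F`. -/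
def Malnormal {G : Type*} [Group G] (F : Subgroup G) : Prop :=
  ∀ g : G, g ∉ F → F ⊓ Subgroup.map (MulAut.conj g).toMonoidHom F = ⊥

/-- The suspension (mapping torus) `F ⋊_Ψ ℤ` of a group by an automorphism:
the semidirect product of `F` with `ℤ` where the generator of `ℤ` acts as `Ψ`. -/
abbrev Suspension (F : Type*) [Group F] (Ψ : MulAut F) :=
  SemidirectProduct F (Multiplicative ℤ) (zpowersHom (MulAut F) Ψ)

theorem map_zpow_mulAut_of_map_eq_conj {N H : Type*} [Group N] [Group H] (fn : N →* H)
    (Ψ : MulAut N) (s : H) (h : ∀ x, fn (Ψ x) = s * fn x * s⁻¹) (n : ℤ) (x : N) :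
    fn ((Ψ ^ n) x) = s ^ n * fn x * (s ^ n)⁻¹ := by
  have h_inv : ∀ x, fn (Ψ⁻¹ x) = s⁻¹ * fn x * s := fun x => by
    have := h (Ψ⁻¹ x)
    rw [MulAut.apply_inv_self] at this
    rw [this]
    group
  induction n generalizing x with
  | zero => simp
  | succ n ih => rw [zpow_add_one, MulAut.mul_apply, ih, h, zpow_add_one]; group
  | pred n ih => rw [zpow_sub_one, MulAut.mul_apply, ih, h_inv, zpow_sub_one]; group

namespace Suspension

open SemidirectProduct

variable {F : Type*} [Group F]

/-- The homomorphism out of a suspension which is `fn` on the fibre and sends the stable letter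
to `s`, given that conjugation by `s` realizes the monodromy. -/
def lift {H : Type*} [Group H] {Ψ : MulAut F} (fn : F →* H) (s : H)
    (h : ∀ x, fn (Ψ x) = s * fn x * s⁻¹) : Suspension F Ψ →* H :=
  SemidirectProduct.lift fn (zpowersHom H s) fun n => by
    ext x
    simpa [zpowersHom_apply, ← map_zpow] using map_zpow_mulAut_of_map_eq_conj fn Ψ s h n.toAdd x

/-- The stable letter of a suspension. -/
def stableLetter (Ψ : MulAut F) : Suspension F Ψ := inr (Multiplicative.ofAdd 1)

theorem inl_apply_eq_conj (Ψ : MulAut F) (x : F) :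
    (inl (Ψ x) : Suspension F Ψ) = stableLetter Ψ * inl x * (stableLetter Ψ)⁻¹ := by
  simpa [zpowersHom_apply, stableLetter] using
    inl_aut (φ := zpowersHom (MulAut F) Ψ) (Multiplicative.ofAdd 1) x

@[simp]
theorem lift_inl {H : Type*} [Group H] {Ψ : MulAut F} (fn : F →* H) (s : H)
    (h : ∀ x, fn (Ψ x) = s * fn x * s⁻¹) (x : F) : lift fn s h (inl x) = fn x :=
  SemidirectProduct.lift_inl ..

@[simp]
theorem lift_stableLetter {H : Type*} [Group H] {Ψ : MulAut F} (fn : F →* H) (s : H)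
    (h : ∀ x, fn (Ψ x) = s * fn x * s⁻¹) : lift fn s h (stableLetter Ψ) = s := by
  simp [lift, stableLetter, zpowersHom_apply]

theorem hom_ext {H : Type*} [Group H] {Ψ : MulAut F} {α β : Suspension F Ψ →* H}
    (hl : ∀ x, α (inl x) = β (inl x)) (hs : α (stableLetter Ψ) = β (stableLetter Ψ)) :
    α = β :=
  SemidirectProduct.hom_ext (MonoidHom.ext hl) (MonoidHom.ext_mint hs)

/-- Automorphisms differing by an inner automorphism have isomorphic suspensions. -/
def congrConjMul {Ψ Ψ' : MulAut F} (f : F) (h : Ψ' = MulAut.conj f * Ψ) :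
    Suspension F Ψ ≃* Suspension F Ψ' :=
  MonoidHom.toMulEquiv
    (lift inl (inl f⁻¹ * stableLetter Ψ') fun x => by
      have hx : Ψ x = f⁻¹ * Ψ' x * f := by simp [h, mul_assoc]
      rw [hx, map_mul, map_mul, inl_apply_eq_conj, map_inv]
      group)
    (lift inl (inl f * stableLetter Ψ) fun x => by
      have hx : Ψ' x = f * Ψ x * f⁻¹ := by simp [h]
      rw [hx, map_mul, map_mul, inl_apply_eq_conj, map_inv]
      group)
    (hom_ext (by simp) (by simp))
    (hom_ext (by simp) (by simp))

end Suspension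

theorem Malnormal.mem_of_map_conj_eq {G : Type*} [Group G] {F : Subgroup G}
    (hmal : Malnormal F) (hnt : F ≠ ⊥) {c : G}
    (hc : F.map (MulAut.conj c).toMonoidHom = F) : c ∈ F := by
  by_contra h
  have := hmal c h
  rw [hc, inf_idem] at this
  exact hnt this

/-- If `F` is a nontrivial malnormal subgroup of `G` and `conj(g)∘Φ`,
`conj(g')∘Φ` both preserve `F`, then `g'·g⁻¹ ∈ F`, the restrictions to `F`
differ by an inner automorphism of `F`, and the two suspensions of `F` are
isomorphic: the suspension `F_Φ` does not depend on the correcting element. -/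
theorem suspension_malnormal_wellDefined {G : Type*} [Group G]
    (F : Subgroup G) (hnt : F ≠ ⊥) (hmal : Malnormal F)
    (Φ : MulAut G) (g g' : G)
    (hg : Subgroup.map (MulAut.conj g * Φ).toMonoidHom F = F)
    (hg' : Subgroup.map (MulAut.conj g' * Φ).toMonoidHom F = F)
    (Ψ Ψ' : MulAut F)
    (hΨ : ∀ h : F, (Ψ h : G) = (MulAut.conj g * Φ) (h : G))
    (hΨ' : ∀ h : F, (Ψ' h : G) = (MulAut.conj g' * Φ) (h : G)) :
    g' * g⁻¹ ∈ F ∧ (∃ f : F, Ψ' = MulAut.conj f * Ψ) ∧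
      Nonempty (Suspension F Ψ ≃* Suspension F Ψ') := by
  have hconj : MulAut.conj g' * Φ = MulAut.conj (g' * g⁻¹) * (MulAut.conj g * Φ) := by
    simp [← mul_assoc, ← map_mul]
  have hmem : g' * g⁻¹ ∈ F := by
    refine hmal.mem_of_map_conj_eq hnt ?_
    conv_lhs => rw [← hg]
    rw [Subgroup.map_map]
    rw [hconj] at hg'
    exact hg'
  have hinner : Ψ' = MulAut.conj (⟨g' * g⁻¹, hmem⟩ : F) * Ψ := by
    ext x
    rw [hΨ', hconj, MulAut.mul_apply, ← hΨ]
    rfl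
  exact ⟨hmem, ⟨_, hinner⟩, ⟨Suspension.congrConjMul _ hinner⟩⟩
end
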